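/- Let T be an invertible block TBT-matrix, {k,p} = {1,2} with k ≠ p, λ_k ∉ {i/2, −i/2}, and set Q₁ = K₁₁M₂₁ + ℒ₁K, Q₂ = K₁₂M₂₂ + ℒ₂K, 𝔄_k(λ_k) = diag{(𝒜_k^*−λ_kI_{m_k})⊗I_{m₃}, (𝒜_k−λ_kI_{m_k})⊗I_{m₃}}. Then Π̂_p (A_k^* − λ_kI)^{−1} = 𝔄_k(λ_k)^{−1}(Π̂_p + i·col[0; Q_k](A_k^* − λ_kI)^{−1}). -/

import Mathlib

open Matrix Kronecker BigOperators

noncomputable section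

namespace TBT

/-- The entries `a_r` of the matrices `𝒜_p`. -/
def aEnt (r : ℤ) : ℂ := if r < 0 then 0 else if r = 0 then Complex.I / 2 else Complex.I

/-- The `n × n` matrix `𝒜 = {a_{j-ℓ}}`. -/
def calA (n : ℕ) : Matrix (Fin n) (Fin n) ℂ :=
  Matrix.of fun j ℓ => aEnt (((j : ℕ) : ℤ) - ((ℓ : ℕ) : ℤ))

/-- The index type of the `m × m` matrices, `m = m₁ m₂ m₃`. -/
abbrev Idx (m₁ m₂ m₃ : ℕ) := (Fin m₁ × Fin m₂) × Fin m₃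

/-- `A₁ = 𝒜₁ ⊗ I_{m₂} ⊗ I_{m₃}`. -/
def A1 (m₁ m₂ m₃ : ℕ) : Matrix (Idx m₁ m₂ m₃) (Idx m₁ m₂ m₃) ℂ :=
  (calA m₁ ⊗ₖ (1 : Matrix (Fin m₂) (Fin m₂) ℂ)) ⊗ₖ (1 : Matrix (Fin m₃) (Fin m₃) ℂ)

/-- `A₂ = I_{m₁} ⊗ 𝒜₂ ⊗ I_{m₃}`. -/
def A2 (m₁ m₂ m₃ : ℕ) : Matrix (Idx m₁ m₂ m₃) (Idx m₁ m₂ m₃) ℂ :=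
  ((1 : Matrix (Fin m₁) (Fin m₁) ℂ) ⊗ₖ calA m₂) ⊗ₖ (1 : Matrix (Fin m₃) (Fin m₃) ℂ)

/-- `A₃ = I_{m₁} ⊗ I_{m₂} ⊗ 𝒜₃`. -/
def A3 (m₁ m₂ m₃ : ℕ) : Matrix (Idx m₁ m₂ m₃) (Idx m₁ m₂ m₃) ℂ :=
  ((1 : Matrix (Fin m₁) (Fin m₁) ℂ) ⊗ₖ (1 : Matrix (Fin m₂) (Fin m₂) ℂ)) ⊗ₖ calA m₃

/-- The block TBT-matrix `T = {𝒯_{i-k}}`, `𝒯_r = {t^{(r)}_{i-k}}`, built from the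
data `t : ℤ → ℤ → Matrix (Fin m₃) (Fin m₃) ℂ` of its `m₃ × m₃` blocks. -/
def Tmat (m₁ m₂ m₃ : ℕ) (t : ℤ → ℤ → Matrix (Fin m₃) (Fin m₃) ℂ) :
    Matrix (Idx m₁ m₂ m₃) (Idx m₁ m₂ m₃) ℂ :=
  Matrix.of fun x y =>
    t (((x.1.1 : ℕ) : ℤ) - ((y.1.1 : ℕ) : ℤ)) (((x.1.2 : ℕ) : ℤ) - ((y.1.2 : ℕ) : ℤ)) x.2 y.2

/-- The Toeplitz blocks `𝒯_r = {t^{(r)}_{i-k}}` of a block TBT-matrix. -/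
def calT (m₂ m₃ : ℕ) (t : ℤ → ℤ → Matrix (Fin m₃) (Fin m₃) ℂ) (r : ℤ) :
    Matrix (Fin m₂ × Fin m₃) (Fin m₂ × Fin m₃) ℂ :=
  Matrix.of fun x y => t r (((x.1 : ℕ) : ℤ) - ((y.1 : ℕ) : ℤ)) x.2 y.2

/-- `M₁₁ = col [M₁₁⁽¹⁾ … M₁₁⁽ᵐ¹⁾]`, `M₁₁⁽ⁱ⁾ = (1/2)𝒯₀ + Σ_{s=1}^{i-1} 𝒯_s`. -/
def M11 (m₁ m₂ m₃ : ℕ) (t : ℤ → ℤ → Matrix (Fin m₃) (Fin m₃) ℂ) :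
    Matrix (Idx m₁ m₂ m₃) (Fin m₂ × Fin m₃) ℂ :=
  Matrix.of fun x y =>
    ((2 : ℂ)⁻¹ • calT m₂ m₃ t 0 +
      ∑ s ∈ Finset.range (x.1.1 : ℕ), calT m₂ m₃ t ((s : ℤ) + 1)) (x.1.2, x.2) y

/-- `M₂₁ = 1_{m₁}^* ⊗ I_{m₂ m₃}`. -/
def M21 (m₁ m₂ m₃ : ℕ) : Matrix (Fin m₂ × Fin m₃) (Idx m₁ m₂ m₃) ℂ :=
  Matrix.of fun y x => if y.1 = x.1.2 ∧ y.2 = x.2 then 1 else 0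

/-- `M₃₁ = M₂₁^*`. -/
def M31 (m₁ m₂ m₃ : ℕ) : Matrix (Idx m₁ m₂ m₃) (Fin m₂ × Fin m₃) ℂ := (M21 m₁ m₂ m₃)ᴴ

/-- `M₄₁ = [M₄₁⁽¹⁾ … M₄₁⁽ᵐ¹⁾]`, `M₄₁⁽ᵏ⁾ = (1/2)𝒯₀ + Σ_{s=1}^{k-1} 𝒯_{-s}`. -/
def M41 (m₁ m₂ m₃ : ℕ) (t : ℤ → ℤ → Matrix (Fin m₃) (Fin m₃) ℂ) :
    Matrix (Fin m₂ × Fin m₃) (Idx m₁ m₂ m₃) ℂ :=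
  Matrix.of fun y x =>
    ((2 : ℂ)⁻¹ • calT m₂ m₃ t 0 +
      ∑ s ∈ Finset.range (x.1.1 : ℕ), calT m₂ m₃ t (-((s : ℤ) + 1))) y (x.1.2, x.2)

/-- The blocks `M₁₂⁽ʳ⁾ = col [(1/2)t₀⁽ʳ⁾, (1/2)t₀⁽ʳ⁾ + t₁⁽ʳ⁾, …]`. -/
def M12blk (m₂ m₃ : ℕ) (t : ℤ → ℤ → Matrix (Fin m₃) (Fin m₃) ℂ) (r : ℤ) :
    Matrix (Fin m₂ × Fin m₃) (Fin m₃) ℂ :=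
  Matrix.of fun x l =>
    ((2 : ℂ)⁻¹ • t r 0 + ∑ j ∈ Finset.range (x.1 : ℕ), t r ((j : ℤ) + 1)) x.2 l

/-- `M₁₂ = {M₁₂^{(i-k)}}_{i,k=1}^{m₁}`. -/
def M12 (m₁ m₂ m₃ : ℕ) (t : ℤ → ℤ → Matrix (Fin m₃) (Fin m₃) ℂ) :
    Matrix (Idx m₁ m₂ m₃) (Fin m₁ × Fin m₃) ℂ :=
  Matrix.of fun x y => M12blk m₂ m₃ t (((x.1.1 : ℕ) : ℤ) - ((y.1 : ℕ) : ℤ)) (x.1.2, x.2) y.2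

/-- `M₂₂ = I_{m₁} ⊗ 1_{m₂}^* ⊗ I_{m₃}`. -/
def M22 (m₁ m₂ m₃ : ℕ) : Matrix (Fin m₁ × Fin m₃) (Idx m₁ m₂ m₃) ℂ :=
  Matrix.of fun y x => if y.1 = x.1.1 ∧ y.2 = x.2 then 1 else 0

/-- `M₃₂ = M₂₂^*`. -/
def M32 (m₁ m₂ m₃ : ℕ) : Matrix (Idx m₁ m₂ m₃) (Fin m₁ × Fin m₃) ℂ := (M22 m₁ m₂ m₃)ᴴ

/-- The blocks `M₄₂⁽ʳ⁾ = [(1/2)t₀⁽ʳ⁾, (1/2)t₀⁽ʳ⁾ + t₋₁⁽ʳ⁾, …]`. -/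
def M42blk (m₂ m₃ : ℕ) (t : ℤ → ℤ → Matrix (Fin m₃) (Fin m₃) ℂ) (r : ℤ) :
    Matrix (Fin m₃) (Fin m₂ × Fin m₃) ℂ :=
  Matrix.of fun l x =>
    ((2 : ℂ)⁻¹ • t r 0 + ∑ j ∈ Finset.range (x.1 : ℕ), t r (-((j : ℤ) + 1))) l x.2

/-- `M₄₂ = {M₄₂^{(i-k)}}_{i,k=1}^{m₁}`. -/
def M42 (m₁ m₂ m₃ : ℕ) (t : ℤ → ℤ → Matrix (Fin m₃) (Fin m₃) ℂ) :
    Matrix (Fin m₁ × Fin m₃) (Idx m₁ m₂ m₃) ℂ :=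
  Matrix.of fun y x => M42blk m₂ m₃ t (((y.1 : ℕ) : ℤ) - ((x.1.1 : ℕ) : ℤ)) y.2 (x.1.2, x.2)

/-- `Π₁ = [M₁₁ M₃₁]`. -/
def Pi1 (m₁ m₂ m₃ : ℕ) (t : ℤ → ℤ → Matrix (Fin m₃) (Fin m₃) ℂ) :
    Matrix (Idx m₁ m₂ m₃) ((Fin m₂ × Fin m₃) ⊕ (Fin m₂ × Fin m₃)) ℂ :=
  Matrix.fromCols (M11 m₁ m₂ m₃ t) (M31 m₁ m₂ m₃)

/-- `Π₂ = [M₁₂ M₃₂]`. -/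
def Pi2 (m₁ m₂ m₃ : ℕ) (t : ℤ → ℤ → Matrix (Fin m₃) (Fin m₃) ℂ) :
    Matrix (Idx m₁ m₂ m₃) ((Fin m₁ × Fin m₃) ⊕ (Fin m₁ × Fin m₃)) ℂ :=
  Matrix.fromCols (M12 m₁ m₂ m₃ t) (M32 m₁ m₂ m₃)

/-- `Π̂₁ = col [M₂₁; M₄₁]`. -/
def Pihat1 (m₁ m₂ m₃ : ℕ) (t : ℤ → ℤ → Matrix (Fin m₃) (Fin m₃) ℂ) :
    Matrix ((Fin m₂ × Fin m₃) ⊕ (Fin m₂ × Fin m₃)) (Idx m₁ m₂ m₃) ℂ :=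
  Matrix.fromRows (M21 m₁ m₂ m₃) (M41 m₁ m₂ m₃ t)

/-- `Π̂₂ = col [M₂₂; M₄₂]`. -/
def Pihat2 (m₁ m₂ m₃ : ℕ) (t : ℤ → ℤ → Matrix (Fin m₃) (Fin m₃) ℂ) :
    Matrix ((Fin m₁ × Fin m₃) ⊕ (Fin m₁ × Fin m₃)) (Idx m₁ m₂ m₃) ℂ :=
  Matrix.fromRows (M22 m₁ m₂ m₃) (M42 m₁ m₂ m₃ t)

/-- `Γ₁ = T⁻¹ Π₁`. -/
def Gamma1 (m₁ m₂ m₃ : ℕ) (t : ℤ → ℤ → Matrix (Fin m₃) (Fin m₃) ℂ) :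
    Matrix (Idx m₁ m₂ m₃) ((Fin m₂ × Fin m₃) ⊕ (Fin m₂ × Fin m₃)) ℂ :=
  (Tmat m₁ m₂ m₃ t)⁻¹ * Pi1 m₁ m₂ m₃ t

/-- `Γ₂ = T⁻¹ Π₂`. -/
def Gamma2 (m₁ m₂ m₃ : ℕ) (t : ℤ → ℤ → Matrix (Fin m₃) (Fin m₃) ℂ) :
    Matrix (Idx m₁ m₂ m₃) ((Fin m₁ × Fin m₃) ⊕ (Fin m₁ × Fin m₃)) ℂ :=
  (Tmat m₁ m₂ m₃ t)⁻¹ * Pi2 m₁ m₂ m₃ t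

/-- `Γ̂₁ = Π̂₁ T⁻¹`. -/
def Gammahat1 (m₁ m₂ m₃ : ℕ) (t : ℤ → ℤ → Matrix (Fin m₃) (Fin m₃) ℂ) :
    Matrix ((Fin m₂ × Fin m₃) ⊕ (Fin m₂ × Fin m₃)) (Idx m₁ m₂ m₃) ℂ :=
  Pihat1 m₁ m₂ m₃ t * (Tmat m₁ m₂ m₃ t)⁻¹

/-- `Γ̂₂ = Π̂₂ T⁻¹`. -/
def Gammahat2 (m₁ m₂ m₃ : ℕ) (t : ℤ → ℤ → Matrix (Fin m₃) (Fin m₃) ℂ) :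
    Matrix ((Fin m₁ × Fin m₃) ⊕ (Fin m₁ × Fin m₃)) (Idx m₁ m₂ m₃) ℂ :=
  Pihat2 m₁ m₂ m₃ t * (Tmat m₁ m₂ m₃ t)⁻¹

/-- `ℒ = 1_{m₁m₂} ⊗ I_{m₃}`. -/
def Lmat (m₁ m₂ m₃ : ℕ) : Matrix (Idx m₁ m₂ m₃) (Fin m₃) ℂ :=
  Matrix.of fun x l => if x.2 = l then 1 else 0

/-- `ℒ_p = 1_{m_p} ⊗ I_{m₃}`. -/
def Lp (n m₃ : ℕ) : Matrix (Fin n × Fin m₃) (Fin m₃) ℂ :=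
  Matrix.of fun x l => if x.2 = l then 1 else 0

/-- A row vector `v` Kronecker the identity `I_{m₃}`. -/
def rowKronId {n : Type*} (m₃ : ℕ) (v : n → ℂ) : Matrix (Fin m₃) (n × Fin m₃) ℂ :=
  Matrix.of fun l x => v x.1 * (if l = x.2 then 1 else 0)

/-- A column vector `v` Kronecker the identity `I_{m₃}`. -/
def colKronId {n : Type*} (m₃ : ℕ) (v : n → ℂ) : Matrix (n × Fin m₃) (Fin m₃) ℂ :=
  Matrix.of fun x l => v x.1 * (if x.2 = l then 1 else 0)

/-- `ω(λ,μ) = ℒ^* (A₁^*-μ₁I)⁻¹ (A₂^*-μ₂I)⁻¹ T⁻¹ (A₁-λ₁I)⁻¹ (A₂-λ₂I)⁻¹ ℒ`. -/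
def omegaF (m₁ m₂ m₃ : ℕ) (t : ℤ → ℤ → Matrix (Fin m₃) (Fin m₃) ℂ) (l₁ l₂ mu₁ mu₂ : ℂ) :
    Matrix (Fin m₃) (Fin m₃) ℂ :=
  (Lmat m₁ m₂ m₃)ᴴ * ((A1 m₁ m₂ m₃)ᴴ - mu₁ • 1)⁻¹ * ((A2 m₁ m₂ m₃)ᴴ - mu₂ • 1)⁻¹ *
    (Tmat m₁ m₂ m₃ t)⁻¹ * (A1 m₁ m₂ m₃ - l₁ • 1)⁻¹ * (A2 m₁ m₂ m₃ - l₂ • 1)⁻¹ *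
    Lmat m₁ m₂ m₃

/-- `v₁(μ) = ℒ^* (A₁^*-μ₁I)⁻¹ (A₂^*-μ₂I)⁻¹ Γ₁`. -/
def v1 (m₁ m₂ m₃ : ℕ) (t : ℤ → ℤ → Matrix (Fin m₃) (Fin m₃) ℂ) (mu₁ mu₂ : ℂ) :
    Matrix (Fin m₃) ((Fin m₂ × Fin m₃) ⊕ (Fin m₂ × Fin m₃)) ℂ :=
  (Lmat m₁ m₂ m₃)ᴴ * ((A1 m₁ m₂ m₃)ᴴ - mu₁ • 1)⁻¹ * ((A2 m₁ m₂ m₃)ᴴ - mu₂ • 1)⁻¹ *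
    Gamma1 m₁ m₂ m₃ t

/-- `v₂(μ) = ℒ^* (A₁^*-μ₁I)⁻¹ (A₂^*-μ₂I)⁻¹ Γ₂`. -/
def v2 (m₁ m₂ m₃ : ℕ) (t : ℤ → ℤ → Matrix (Fin m₃) (Fin m₃) ℂ) (mu₁ mu₂ : ℂ) :
    Matrix (Fin m₃) ((Fin m₁ × Fin m₃) ⊕ (Fin m₁ × Fin m₃)) ℂ :=
  (Lmat m₁ m₂ m₃)ᴴ * ((A1 m₁ m₂ m₃)ᴴ - mu₁ • 1)⁻¹ * ((A2 m₁ m₂ m₃)ᴴ - mu₂ • 1)⁻¹ *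
    Gamma2 m₁ m₂ m₃ t

/-- `v̂₁(λ) = Γ̂₁ (A₁-λ₁I)⁻¹ (A₂-λ₂I)⁻¹ ℒ`. -/
def vhat1 (m₁ m₂ m₃ : ℕ) (t : ℤ → ℤ → Matrix (Fin m₃) (Fin m₃) ℂ) (l₁ l₂ : ℂ) :
    Matrix ((Fin m₂ × Fin m₃) ⊕ (Fin m₂ × Fin m₃)) (Fin m₃) ℂ :=
  Gammahat1 m₁ m₂ m₃ t * (A1 m₁ m₂ m₃ - l₁ • 1)⁻¹ * (A2 m₁ m₂ m₃ - l₂ • 1)⁻¹ * Lmat m₁ m₂ m₃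

/-- `v̂₂(λ) = Γ̂₂ (A₁-λ₁I)⁻¹ (A₂-λ₂I)⁻¹ ℒ`. -/
def vhat2 (m₁ m₂ m₃ : ℕ) (t : ℤ → ℤ → Matrix (Fin m₃) (Fin m₃) ℂ) (l₁ l₂ : ℂ) :
    Matrix ((Fin m₁ × Fin m₃) ⊕ (Fin m₁ × Fin m₃)) (Fin m₃) ℂ :=
  Gammahat2 m₁ m₂ m₃ t * (A1 m₁ m₂ m₃ - l₁ • 1)⁻¹ * (A2 m₁ m₂ m₃ - l₂ • 1)⁻¹ * Lmat m₁ m₂ m₃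

/-- `u₁(μ) = v₁(μ) - i (1_{m₂}^* (𝒜₂^*-μ₂I)⁻¹ ⊗ I_{m₃}) [I_{m₂m₃} 0]`. -/
def u1 (m₁ m₂ m₃ : ℕ) (t : ℤ → ℤ → Matrix (Fin m₃) (Fin m₃) ℂ) (mu₁ mu₂ : ℂ) :
    Matrix (Fin m₃) ((Fin m₂ × Fin m₃) ⊕ (Fin m₂ × Fin m₃)) ℂ :=
  v1 m₁ m₂ m₃ t mu₁ mu₂ -
    Complex.I • Matrix.fromCols
      (rowKronId m₃ (Matrix.vecMul (fun _ : Fin m₂ => (1 : ℂ)) (((calA m₂)ᴴ - mu₂ • 1)⁻¹))) 0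

/-- `u₂(μ) = v₂(μ) - i (1_{m₁}^* (𝒜₁^*-μ₁I)⁻¹ ⊗ I_{m₃}) [I_{m₁m₃} 0]`. -/
def u2 (m₁ m₂ m₃ : ℕ) (t : ℤ → ℤ → Matrix (Fin m₃) (Fin m₃) ℂ) (mu₁ mu₂ : ℂ) :
    Matrix (Fin m₃) ((Fin m₁ × Fin m₃) ⊕ (Fin m₁ × Fin m₃)) ℂ :=
  v2 m₁ m₂ m₃ t mu₁ mu₂ -
    Complex.I • Matrix.fromCols
      (rowKronId m₃ (Matrix.vecMul (fun _ : Fin m₁ => (1 : ℂ)) (((calA m₁)ᴴ - mu₁ • 1)⁻¹))) 0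

/-- `û₁(λ) = v̂₁(λ) + i col[0; I_{m₂m₃}] ((𝒜₂-λ₂I)⁻¹ 1_{m₂} ⊗ I_{m₃})`. -/
def uhat1 (m₁ m₂ m₃ : ℕ) (t : ℤ → ℤ → Matrix (Fin m₃) (Fin m₃) ℂ) (l₁ l₂ : ℂ) :
    Matrix ((Fin m₂ × Fin m₃) ⊕ (Fin m₂ × Fin m₃)) (Fin m₃) ℂ :=
  vhat1 m₁ m₂ m₃ t l₁ l₂ +
    Complex.I • Matrix.fromRows 0
      (colKronId m₃ (Matrix.mulVec ((calA m₂ - l₂ • 1)⁻¹) (fun _ : Fin m₂ => (1 : ℂ))))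

/-- `û₂(λ) = v̂₂(λ) + i col[0; I_{m₁m₃}] ((𝒜₁-λ₁I)⁻¹ 1_{m₁} ⊗ I_{m₃})`. -/
def uhat2 (m₁ m₂ m₃ : ℕ) (t : ℤ → ℤ → Matrix (Fin m₃) (Fin m₃) ℂ) (l₁ l₂ : ℂ) :
    Matrix ((Fin m₁ × Fin m₃) ⊕ (Fin m₁ × Fin m₃)) (Fin m₃) ℂ :=
  vhat2 m₁ m₂ m₃ t l₁ l₂ +
    Complex.I • Matrix.fromRows 0
      (colKronId m₃ (Matrix.mulVec ((calA m₁ - l₁ • 1)⁻¹) (fun _ : Fin m₁ => (1 : ℂ))))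

/-- `K₁₁ = col [(1/2)M₄₂⁽⁰⁾, (1/2)M₄₂⁽⁰⁾+M₄₂⁽¹⁾, …]`. -/
def K11 (m₁ m₂ m₃ : ℕ) (t : ℤ → ℤ → Matrix (Fin m₃) (Fin m₃) ℂ) :
    Matrix (Fin m₁ × Fin m₃) (Fin m₂ × Fin m₃) ℂ :=
  Matrix.of fun y x =>
    ((2 : ℂ)⁻¹ • M42blk m₂ m₃ t 0 +
      ∑ j ∈ Finset.range (y.1 : ℕ), M42blk m₂ m₃ t ((j : ℤ) + 1)) y.2 x

/-- `K₁₂ = [(1/2)M₁₂⁽⁰⁾, (1/2)M₁₂⁽⁰⁾+M₁₂⁽⁻¹⁾, …]`. -/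
def K12 (m₁ m₂ m₃ : ℕ) (t : ℤ → ℤ → Matrix (Fin m₃) (Fin m₃) ℂ) :
    Matrix (Fin m₂ × Fin m₃) (Fin m₁ × Fin m₃) ℂ :=
  Matrix.of fun y x =>
    ((2 : ℂ)⁻¹ • M12blk m₂ m₃ t 0 +
      ∑ j ∈ Finset.range (x.1 : ℕ), M12blk m₂ m₃ t (-((j : ℤ) + 1))) y x.2

/-- `K = [(1/2)M₄₂⁽⁰⁾, (1/2)M₄₂⁽⁰⁾+M₄₂⁽⁻¹⁾, …]`. -/
def Kmat (m₁ m₂ m₃ : ℕ) (t : ℤ → ℤ → Matrix (Fin m₃) (Fin m₃) ℂ) :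
    Matrix (Fin m₃) (Idx m₁ m₂ m₃) ℂ :=
  Matrix.of fun l x =>
    ((2 : ℂ)⁻¹ • M42blk m₂ m₃ t 0 +
      ∑ j ∈ Finset.range (x.1.1 : ℕ), M42blk m₂ m₃ t (-((j : ℤ) + 1))) l (x.1.2, x.2)

/-- `N = col [(1/2)M₁₂⁽⁰⁾, (1/2)M₁₂⁽⁰⁾+M₁₂⁽¹⁾, …]`. -/
def Nmat (m₁ m₂ m₃ : ℕ) (t : ℤ → ℤ → Matrix (Fin m₃) (Fin m₃) ℂ) :
    Matrix (Idx m₁ m₂ m₃) (Fin m₃) ℂ :=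
  Matrix.of fun x l =>
    ((2 : ℂ)⁻¹ • M12blk m₂ m₃ t 0 +
      ∑ j ∈ Finset.range (x.1.1 : ℕ), M12blk m₂ m₃ t ((j : ℤ) + 1)) (x.1.2, x.2) l

/-- `diag {(𝒜-zI) ⊗ I_{m₃}, (𝒜-zI) ⊗ I_{m₃}}` (the diagonal blocks `G₁₁`, `G₂₂`). -/
def diagKron (n m₃ : ℕ) (z : ℂ) :
    Matrix ((Fin n × Fin m₃) ⊕ (Fin n × Fin m₃)) ((Fin n × Fin m₃) ⊕ (Fin n × Fin m₃)) ℂ :=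
  Matrix.fromBlocks ((calA n - z • 1) ⊗ₖ (1 : Matrix (Fin m₃) (Fin m₃) ℂ)) 0 0
    ((calA n - z • 1) ⊗ₖ (1 : Matrix (Fin m₃) (Fin m₃) ℂ))

/-- `diag {(𝒜^*-zI) ⊗ I_{m₃}, (𝒜^*-zI) ⊗ I_{m₃}}` (the diagonal blocks `E₁₁`, `E₂₂`). -/
def diagKronH (n m₃ : ℕ) (z : ℂ) :
    Matrix ((Fin n × Fin m₃) ⊕ (Fin n × Fin m₃)) ((Fin n × Fin m₃) ⊕ (Fin n × Fin m₃)) ℂ :=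
  Matrix.fromBlocks (((calA n)ᴴ - z • 1) ⊗ₖ (1 : Matrix (Fin m₃) (Fin m₃) ℂ)) 0 0
    (((calA n)ᴴ - z • 1) ⊗ₖ (1 : Matrix (Fin m₃) (Fin m₃) ℂ))

/-- `𝔄(z) = diag {(𝒜^*-zI) ⊗ I_{m₃}, (𝒜-zI) ⊗ I_{m₃}}`. -/
def frakA (n m₃ : ℕ) (z : ℂ) :
    Matrix ((Fin n × Fin m₃) ⊕ (Fin n × Fin m₃)) ((Fin n × Fin m₃) ⊕ (Fin n × Fin m₃)) ℂ :=
  Matrix.fromBlocks (((calA n)ᴴ - z • 1) ⊗ₖ (1 : Matrix (Fin m₃) (Fin m₃) ℂ)) 0 0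
    ((calA n - z • 1) ⊗ₖ (1 : Matrix (Fin m₃) (Fin m₃) ℂ))

/-- `G₁₂ = i (Π̂₁ Γ₂ - [[ℒ₂ℒ₁^*, 0], [K₁₂, 0]])`. -/
def G12 (m₁ m₂ m₃ : ℕ) (t : ℤ → ℤ → Matrix (Fin m₃) (Fin m₃) ℂ) :
    Matrix ((Fin m₂ × Fin m₃) ⊕ (Fin m₂ × Fin m₃)) ((Fin m₁ × Fin m₃) ⊕ (Fin m₁ × Fin m₃)) ℂ :=
  Complex.I • (Pihat1 m₁ m₂ m₃ t * Gamma2 m₁ m₂ m₃ t -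
    Matrix.fromBlocks (Lp m₂ m₃ * (Lp m₁ m₃)ᴴ) 0 (K12 m₁ m₂ m₃ t) 0)

/-- `G₂₁ = i (Π̂₂ Γ₁ - [[ℒ₁ℒ₂^*, 0], [K₁₁, 0]])`. -/
def G21 (m₁ m₂ m₃ : ℕ) (t : ℤ → ℤ → Matrix (Fin m₃) (Fin m₃) ℂ) :
    Matrix ((Fin m₁ × Fin m₃) ⊕ (Fin m₁ × Fin m₃)) ((Fin m₂ × Fin m₃) ⊕ (Fin m₂ × Fin m₃)) ℂ :=
  Complex.I • (Pihat2 m₁ m₂ m₃ t * Gamma1 m₁ m₂ m₃ t -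
    Matrix.fromBlocks (Lp m₁ m₃ * (Lp m₂ m₃)ᴴ) 0 (K11 m₁ m₂ m₃ t) 0)

/-- `G(λ) = [[G₁₁(λ₂), G₁₂], [G₂₁, G₂₂(λ₁)]]`. -/
def Gmat (m₁ m₂ m₃ : ℕ) (t : ℤ → ℤ → Matrix (Fin m₃) (Fin m₃) ℂ) (l₁ l₂ : ℂ) :
    Matrix ((((Fin m₂ × Fin m₃) ⊕ (Fin m₂ × Fin m₃))) ⊕ (((Fin m₁ × Fin m₃) ⊕ (Fin m₁ × Fin m₃))))
      ((((Fin m₂ × Fin m₃) ⊕ (Fin m₂ × Fin m₃))) ⊕ (((Fin m₁ × Fin m₃) ⊕ (Fin m₁ × Fin m₃)))) ℂ :=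
  Matrix.fromBlocks (diagKron m₂ m₃ l₂) (G12 m₁ m₂ m₃ t) (G21 m₁ m₂ m₃ t) (diagKron m₁ m₃ l₁)

/-- `E₁₂ = -i (Π̂₁ Γ₂ - [[0, 0], [K₁₂, ℒ₂ℒ₁^*]])`. -/
def E12m (m₁ m₂ m₃ : ℕ) (t : ℤ → ℤ → Matrix (Fin m₃) (Fin m₃) ℂ) :
    Matrix ((Fin m₂ × Fin m₃) ⊕ (Fin m₂ × Fin m₃)) ((Fin m₁ × Fin m₃) ⊕ (Fin m₁ × Fin m₃)) ℂ :=
  (-Complex.I) • (Pihat1 m₁ m₂ m₃ t * Gamma2 m₁ m₂ m₃ t -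
    Matrix.fromBlocks 0 0 (K12 m₁ m₂ m₃ t) (Lp m₂ m₃ * (Lp m₁ m₃)ᴴ))

/-- `E₂₁ = -i (Π̂₂ Γ₁ - [[0, 0], [K₁₁, ℒ₁ℒ₂^*]])`. -/
def E21m (m₁ m₂ m₃ : ℕ) (t : ℤ → ℤ → Matrix (Fin m₃) (Fin m₃) ℂ) :
    Matrix ((Fin m₁ × Fin m₃) ⊕ (Fin m₁ × Fin m₃)) ((Fin m₂ × Fin m₃) ⊕ (Fin m₂ × Fin m₃)) ℂ :=
  (-Complex.I) • (Pihat2 m₁ m₂ m₃ t * Gamma1 m₁ m₂ m₃ t -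
    Matrix.fromBlocks 0 0 (K11 m₁ m₂ m₃ t) (Lp m₁ m₃ * (Lp m₂ m₃)ᴴ))

/-- `E(μ) = [[E₁₁(μ₂), E₁₂], [E₂₁, E₂₂(μ₁)]]`. -/
def Emat (m₁ m₂ m₃ : ℕ) (t : ℤ → ℤ → Matrix (Fin m₃) (Fin m₃) ℂ) (mu₁ mu₂ : ℂ) :
    Matrix ((((Fin m₂ × Fin m₃) ⊕ (Fin m₂ × Fin m₃))) ⊕ (((Fin m₁ × Fin m₃) ⊕ (Fin m₁ × Fin m₃))))
      ((((Fin m₂ × Fin m₃) ⊕ (Fin m₂ × Fin m₃))) ⊕ (((Fin m₁ × Fin m₃) ⊕ (Fin m₁ × Fin m₃)))) ℂ :=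
  Matrix.fromBlocks (diagKronH m₂ m₃ mu₂) (E12m m₁ m₂ m₃ t) (E21m m₁ m₂ m₃ t) (diagKronH m₁ m₃ mu₁)

/-- `θ(λ) = i (I_{m₃} + K R (A₁-λ₁I)⁻¹ (A₂-λ₂I)⁻¹ ℒ)`. -/
def theta (m₁ m₂ m₃ : ℕ) (t : ℤ → ℤ → Matrix (Fin m₃) (Fin m₃) ℂ) (l₁ l₂ : ℂ) :
    Matrix (Fin m₃) (Fin m₃) ℂ :=
  Complex.I • (1 + Kmat m₁ m₂ m₃ t * (Tmat m₁ m₂ m₃ t)⁻¹ *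
    (A1 m₁ m₂ m₃ - l₁ • 1)⁻¹ * (A2 m₁ m₂ m₃ - l₂ • 1)⁻¹ * Lmat m₁ m₂ m₃)

/-- `ϑ(μ) = -i (I_{m₃} + ℒ^* (A₁^*-μ₁I)⁻¹ (A₂^*-μ₂I)⁻¹ R N)`. -/
def vartheta (m₁ m₂ m₃ : ℕ) (t : ℤ → ℤ → Matrix (Fin m₃) (Fin m₃) ℂ) (mu₁ mu₂ : ℂ) :
    Matrix (Fin m₃) (Fin m₃) ℂ :=
  (-Complex.I) • (1 + (Lmat m₁ m₂ m₃)ᴴ * ((A1 m₁ m₂ m₃)ᴴ - mu₁ • 1)⁻¹ *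
    ((A2 m₁ m₂ m₃)ᴴ - mu₂ • 1)⁻¹ * (Tmat m₁ m₂ m₃ t)⁻¹ * Nmat m₁ m₂ m₃ t)

/-- The exchange (anti-diagonal) matrix `U_n = {δ_{n-i-k+1}}`. -/
def Up (n : ℕ) : Matrix (Fin n) (Fin n) ℂ :=
  Matrix.of fun i k => if (i : ℕ) + (k : ℕ) + 1 = n then 1 else 0

/-- `U = U₁ ⊗ U₂ ⊗ U₃`. -/
def Umat (m₁ m₂ m₃ : ℕ) : Matrix (Idx m₁ m₂ m₃) (Idx m₁ m₂ m₃) ℂ :=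
  (Up m₁ ⊗ₖ Up m₂) ⊗ₖ Up m₃

/-- `Ũ_k = [[0, -(U_k ⊗ U₃)], [U_k ⊗ U₃, 0]]`. -/
def Utilde (n m₃ : ℕ) :
    Matrix ((Fin n × Fin m₃) ⊕ (Fin n × Fin m₃)) ((Fin n × Fin m₃) ⊕ (Fin n × Fin m₃)) ℂ :=
  Matrix.fromBlocks 0 (-(Up n ⊗ₖ Up m₃)) (Up n ⊗ₖ Up m₃) 0

/-- The DSTU property: `U₃ t_j^{(r)} U₃ = (t_j^{(r)})ᵀ` for all blocks. -/
def DSTU (m₃ : ℕ) (t : ℤ → ℤ → Matrix (Fin m₃) (Fin m₃) ℂ) : Prop :=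
  ∀ r j : ℤ, Up m₃ * t r j * Up m₃ = (t r j)ᵀ

/-- `q(μ) = ((μ₁-i/2)/(μ₁+i/2))^{m₁} ((μ₂-i/2)/(μ₂+i/2))^{m₂}`. -/
def qfun (m₁ m₂ : ℕ) (mu₁ mu₂ : ℂ) : ℂ :=
  ((mu₁ - Complex.I / 2) / (mu₁ + Complex.I / 2)) ^ m₁ *
    ((mu₂ - Complex.I / 2) / (mu₂ + Complex.I / 2)) ^ m₂

lemma aux_tau (τ : ℤ → ℂ) (a b : ℕ) :
    τ ((a:ℤ) - b) + ∑ c ∈ Finset.range a, τ ((c:ℤ) - b) + ∑ c ∈ Finset.range b, τ ((a:ℤ) - c)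
      = τ 0 + ∑ j ∈ Finset.range a, τ ((j:ℤ) + 1) + ∑ j ∈ Finset.range b, τ (-((j:ℤ) + 1)) := by
  induction a with
  | zero =>
    have h1 := Finset.sum_range_succ (fun c : ℕ => τ (-(c:ℤ))) b
    have h2 := Finset.sum_range_succ' (fun c : ℕ => τ (-(c:ℤ))) b
    simp only [Nat.cast_zero, zero_sub, Finset.range_zero, Finset.sum_empty, Nat.cast_add,
      Nat.cast_one, neg_zero] at h1 h2 ⊢
    linear_combination h2 - h1
  | succ a ih =>
    have h := Finset.sum_range_sub' (fun c : ℕ => τ ((a:ℤ) + 1 - c)) b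
    rw [Finset.sum_range_succ, Finset.sum_range_succ]
    rw [Finset.sum_sub_distrib] at h
    have h3 : ∑ c ∈ Finset.range b, τ ((a:ℤ) + 1 - ((c + 1 : ℕ):ℤ))
        = ∑ c ∈ Finset.range b, τ ((a:ℤ) - c) := by
      refine Finset.sum_congr rfl fun c _ => ?_
      congr 1; push_cast; ring
    rw [h3] at h
    simp only [Nat.cast_add, Nat.cast_one, Nat.cast_zero, sub_zero] at h ⊢
    linear_combination ih + h

lemma aux_sum (n : ℕ) (a : Fin n) (f : ℕ → ℂ) :
    ∑ c : Fin n, aEnt (((a:ℕ):ℤ) - ((c:ℕ):ℤ)) * f c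
      = Complex.I * ((2:ℂ)⁻¹ * f a + ∑ c ∈ Finset.range a, f c) := by
  rw [Fin.sum_univ_eq_sum_range (fun c => aEnt (((a:ℕ):ℤ) - (c:ℤ)) * f c)]
  have key : ∀ N, (a:ℕ) + 1 ≤ N → ∑ c ∈ Finset.range N, aEnt (((a:ℕ):ℤ) - (c:ℤ)) * f c
      = Complex.I * ((2:ℂ)⁻¹ * f a + ∑ c ∈ Finset.range a, f c) := by
    intro N hN
    induction N, hN using Nat.le_induction with
    | base =>
      rw [Finset.sum_range_succ, mul_add, Finset.mul_sum]
      have : ∑ c ∈ Finset.range a, aEnt (((a:ℕ):ℤ) - (c:ℤ)) * f c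
          = ∑ c ∈ Finset.range a, Complex.I * f c := by
        refine Finset.sum_congr rfl fun c hc => ?_
        have hc := Finset.mem_range.1 hc
        rw [aEnt, if_neg (by omega), if_neg (by omega)]
      rw [this]
      simp [aEnt]; ring
    | succ N hN ih =>
      rw [Finset.sum_range_succ, ih, aEnt, if_pos (by omega)]; simp
  exact key n a.2

lemma star_aEnt (r : ℤ) : star (aEnt r) = - aEnt r := by
  unfold aEnt; split_ifs <;> simp [neg_div]

/-- Scalar identity. -/
lemma aux_main (n : ℕ) (τ : ℤ → ℂ) (a b : Fin n) :
    ∑ c : Fin n, calA n a c * τ (((c:ℕ):ℤ) - ((b:ℕ):ℤ))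
      - ∑ c : Fin n, τ (((a:ℕ):ℤ) - ((c:ℕ):ℤ)) * (calA n)ᴴ c b
    = Complex.I * (((2:ℂ)⁻¹ * τ 0 + ∑ j ∈ Finset.range a, τ ((j:ℤ) + 1)) +
        ((2:ℂ)⁻¹ * τ 0 + ∑ j ∈ Finset.range b, τ (-((j:ℤ) + 1)))) := by
  have h1 := aux_sum n a (fun c => τ ((c:ℤ) - ((b:ℕ):ℤ)))
  have h2 := aux_sum n b (fun c => τ (((a:ℕ):ℤ) - (c:ℤ)))
  have h3 := aux_tau τ a b
  have h4 : ∑ c : Fin n, τ (((a:ℕ):ℤ) - ((c:ℕ):ℤ)) * (calA n)ᴴ c b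
      = - ∑ c : Fin n, aEnt (((b:ℕ):ℤ) - ((c:ℕ):ℤ)) * τ (((a:ℕ):ℤ) - ((c:ℕ):ℤ)) := by
    rw [← Finset.sum_neg_distrib]
    refine Finset.sum_congr rfl fun c _ => ?_
    rw [conjTranspose_apply, calA, of_apply, star_aEnt]; ring
  rw [h4, h2]
  simp only [calA, of_apply]
  rw [h1]
  linear_combination Complex.I * h3

lemma isUnit_calA (n : ℕ) (z : ℂ) (h : z ≠ Complex.I / 2) : IsUnit (calA n - z • 1).det := by
  rw [Matrix.det_of_lowerTriangular]
  · rw [isUnit_iff_ne_zero, Finset.prod_ne_zero_iff]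
    intro i _
    simpa [calA, aEnt, sub_eq_zero] using h.symm
  · intro i j hij
    have hij : (i:ℕ) < j := hij
    have hne : i ≠ j := by rintro rfl; omega
    have : ((i:ℕ):ℤ) < ((j:ℕ):ℤ) := by exact_mod_cast hij
    rw [Matrix.sub_apply, Matrix.smul_apply, Matrix.one_apply_ne hne, calA, of_apply, aEnt,
      if_pos (by omega)]
    simp

lemma isUnit_calAH (n : ℕ) (z : ℂ) (h : z ≠ -(Complex.I / 2)) :
    IsUnit ((calA n)ᴴ - z • 1).det := by
  have e : (calA n)ᴴ - z • 1 = (calA n - (star z) • 1)ᴴ := by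
    rw [conjTranspose_sub, conjTranspose_smul, conjTranspose_one, star_star]
  rw [e, det_conjTranspose]
  refine (isUnit_calA n (star z) ?_).star
  intro h'
  apply h
  have := congrArg star h'
  rw [star_star] at this
  rw [this]; simp [neg_div]

lemma isUnit_frakA (n m : ℕ) (z : ℂ) (h : z ≠ Complex.I / 2) (h' : z ≠ -(Complex.I / 2)) :
    IsUnit (frakA n m z).det := by
  rw [frakA, det_fromBlocks_zero₂₁, det_kronecker, det_kronecker]
  simp only [det_one, one_pow, mul_one]
  exact ((isUnit_calAH n z h').pow _).mul ((isUnit_calA n z h).pow _)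

lemma A1H_eq (m₁ m₂ m₃ : ℕ) (z : ℂ) : (A1 m₁ m₂ m₃)ᴴ - z • 1 =
    (((calA m₁)ᴴ - z • 1) ⊗ₖ (1 : Matrix (Fin m₂) (Fin m₂) ℂ)) ⊗ₖ
      (1 : Matrix (Fin m₃) (Fin m₃) ℂ) := by
  rw [A1, conjTranspose_kronecker, conjTranspose_kronecker, conjTranspose_one, conjTranspose_one]
  ext ⟨⟨a, b⟩, c⟩ ⟨⟨a', b'⟩, c'⟩
  simp [kroneckerMap_apply, one_apply]
  by_cases h1 : a = a' <;> by_cases h2 : b = b' <;> by_cases h3 : c = c' <;> simp [h1, h2, h3]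

lemma A2H_eq (m₁ m₂ m₃ : ℕ) (z : ℂ) : (A2 m₁ m₂ m₃)ᴴ - z • 1 =
    ((1 : Matrix (Fin m₁) (Fin m₁) ℂ) ⊗ₖ ((calA m₂)ᴴ - z • 1)) ⊗ₖ
      (1 : Matrix (Fin m₃) (Fin m₃) ℂ) := by
  rw [A2, conjTranspose_kronecker, conjTranspose_kronecker, conjTranspose_one, conjTranspose_one]
  ext ⟨⟨a, b⟩, c⟩ ⟨⟨a', b'⟩, c'⟩
  simp [kroneckerMap_apply, one_apply]
  by_cases h1 : a = a' <;> by_cases h2 : b = b' <;> by_cases h3 : c = c' <;> simp [h1, h2, h3]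

lemma isUnit_A1H (m₁ m₂ m₃ : ℕ) (z : ℂ) (h : z ≠ -(Complex.I / 2)) :
    IsUnit ((A1 m₁ m₂ m₃)ᴴ - z • 1).det := by
  rw [A1H_eq, det_kronecker, det_kronecker]
  simp only [det_one, one_pow, mul_one]
  exact ((isUnit_calAH m₁ z h).pow _).pow _

lemma isUnit_A2H (m₁ m₂ m₃ : ℕ) (z : ℂ) (h : z ≠ -(Complex.I / 2)) :
    IsUnit ((A2 m₁ m₂ m₃)ᴴ - z • 1).det := by
  rw [A2H_eq, det_kronecker, det_kronecker]
  simp only [det_one, one_pow, one_mul, mul_one]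
  exact ((isUnit_calAH m₂ z h).pow _).pow _

lemma conj_step {n m : Type*} [Fintype n] [DecidableEq n] [Fintype m] [DecidableEq m]
    (F : Matrix n n ℂ) (B : Matrix m m ℂ) (P Q : Matrix n m ℂ)
    (hF : IsUnit F.det) (hB : IsUnit B.det) (h : F * P = P * B + Complex.I • Q) :
    P * B⁻¹ = F⁻¹ * (P + Complex.I • (Q * B⁻¹)) := by
  have : P + Complex.I • (Q * B⁻¹) = F * (P * B⁻¹) := by
    rw [← Matrix.mul_assoc, h, Matrix.add_mul, Matrix.mul_assoc P, mul_nonsing_inv B hB,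
      Matrix.mul_one, smul_mul]
  rw [this, ← Matrix.mul_assoc, nonsing_inv_mul F hF, Matrix.one_mul]

lemma kron_mul_apply {n m₃ : ℕ} {κ : Type*} (C : Matrix (Fin n) (Fin n) ℂ)
    (P : Matrix (Fin n × Fin m₃) κ ℂ) (a : Fin n) (l : Fin m₃) (x : κ) :
    ((C ⊗ₖ (1 : Matrix (Fin m₃) (Fin m₃) ℂ)) * P) (a, l) x = ∑ c, C a c * P (c, l) x := by
  simp [mul_apply, Fintype.sum_prod_type, kroneckerMap_apply, one_apply]

lemma mul_kron1_apply {m₁ m₂ m₃ : ℕ} {κ : Type*} (C : Matrix (Fin m₁) (Fin m₁) ℂ)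
    (P : Matrix κ (Idx m₁ m₂ m₃) ℂ) (y : κ) (a : Fin m₁) (b : Fin m₂) (l : Fin m₃) :
    (P * ((C ⊗ₖ (1 : Matrix (Fin m₂) (Fin m₂) ℂ)) ⊗ₖ (1 : Matrix (Fin m₃) (Fin m₃) ℂ)))
      y ((a, b), l) = ∑ c, P y ((c, b), l) * C c a := by
  simp [mul_apply, Fintype.sum_prod_type, kroneckerMap_apply, one_apply]

lemma mul_kron2_apply {m₁ m₂ m₃ : ℕ} {κ : Type*} (C : Matrix (Fin m₂) (Fin m₂) ℂ)
    (P : Matrix κ (Idx m₁ m₂ m₃) ℂ) (y : κ) (a : Fin m₁) (b : Fin m₂) (l : Fin m₃) :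
    (P * (((1 : Matrix (Fin m₁) (Fin m₁) ℂ) ⊗ₖ C) ⊗ₖ (1 : Matrix (Fin m₃) (Fin m₃) ℂ)))
      y ((a, b), l) = ∑ c, P y ((a, c), l) * C c b := by
  simp [mul_apply, Fintype.sum_prod_type, kroneckerMap_apply, one_apply]

lemma aux_main_z (n : ℕ) (z : ℂ) (τ : ℤ → ℂ) (a b : Fin n) :
    ∑ c : Fin n, (calA n - z • 1) a c * τ (((c:ℕ):ℤ) - ((b:ℕ):ℤ))
    = ∑ c : Fin n, τ (((a:ℕ):ℤ) - ((c:ℕ):ℤ)) * ((calA n)ᴴ - z • 1) c b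
     + Complex.I * (((2:ℂ)⁻¹ * τ 0 + ∑ j ∈ Finset.range a, τ ((j:ℤ) + 1)) +
        ((2:ℂ)⁻¹ * τ 0 + ∑ j ∈ Finset.range b, τ (-((j:ℤ) + 1)))) := by
  rw [← aux_main]
  simp only [Matrix.sub_apply, Matrix.smul_apply, one_apply, sub_mul, mul_sub, Finset.sum_sub_distrib,
    smul_eq_mul, mul_ite, ite_mul, mul_one, mul_zero, zero_mul, Finset.sum_ite_eq,
    Finset.sum_ite_eq', Finset.mem_univ, if_true]
  ring

lemma Lp_mul_apply (n m₃ : ℕ) {κ : Type*} (P : Matrix (Fin m₃) κ ℂ) (a : Fin n) (l : Fin m₃)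
    (x : κ) : (Lp n m₃ * P) (a, l) x = P l x := by
  simp [mul_apply, Lp]

lemma mul_M21_apply {m₁ m₂ m₃ : ℕ} {κ : Type*} (P : Matrix κ (Fin m₂ × Fin m₃) ℂ) (y : κ)
    (a : Fin m₁) (b : Fin m₂) (l : Fin m₃) :
    (P * M21 m₁ m₂ m₃) y ((a, b), l) = P y (b, l) := by
  simp [mul_apply, M21, Fintype.sum_prod_type, ite_and]

lemma mul_M22_apply {m₁ m₂ m₃ : ℕ} {κ : Type*} (P : Matrix κ (Fin m₁ × Fin m₃) ℂ) (y : κ)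
    (a : Fin m₁) (b : Fin m₂) (l : Fin m₃) :
    (P * M22 m₁ m₂ m₃) y ((a, b), l) = P y (a, l) := by
  simp [mul_apply, M22, Fintype.sum_prod_type, ite_and]

lemma main1 (m₁ m₂ m₃ : ℕ) (t : ℤ → ℤ → Matrix (Fin m₃) (Fin m₃) ℂ) (z : ℂ) :
    frakA m₁ m₃ z * Pihat2 m₁ m₂ m₃ t = Pihat2 m₁ m₂ m₃ t * ((A1 m₁ m₂ m₃)ᴴ - z • 1) +
      Complex.I • Matrix.fromRows 0
            (K11 m₁ m₂ m₃ t * M21 m₁ m₂ m₃ + Lp m₁ m₃ * Kmat m₁ m₂ m₃ t) := by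
  rw [A1H_eq, Pihat2, frakA, fromBlocks_mul_fromRows, fromRows_mul]
  ext (⟨a, l⟩ | ⟨a, l⟩) ⟨⟨b, d⟩, l'⟩
  · simp only [Matrix.add_apply, Matrix.smul_apply, fromRows_apply_inl, Matrix.zero_mul, add_zero, Matrix.zero_apply,
      smul_zero, kron_mul_apply, mul_kron1_apply]
    simp [M22, ite_and]
  · simp only [Matrix.add_apply, Matrix.smul_apply, fromRows_apply_inr, Matrix.zero_mul, zero_add,
      kron_mul_apply, mul_kron1_apply, Lp_mul_apply, mul_M21_apply]
    have := aux_main_z m₁ z (fun r => M42blk m₂ m₃ t r l (d, l')) a b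
    simpa only [M42, K11, Kmat, of_apply, Matrix.add_apply, Matrix.smul_apply, Matrix.sum_apply,
      smul_eq_mul] using this

lemma main2 (m₁ m₂ m₃ : ℕ) (t : ℤ → ℤ → Matrix (Fin m₃) (Fin m₃) ℂ) (z : ℂ) :
    frakA m₂ m₃ z * Pihat1 m₁ m₂ m₃ t = Pihat1 m₁ m₂ m₃ t * ((A2 m₁ m₂ m₃)ᴴ - z • 1) +
      Complex.I • Matrix.fromRows 0
            (K12 m₁ m₂ m₃ t * M22 m₁ m₂ m₃ + Lp m₂ m₃ * Kmat m₁ m₂ m₃ t) := by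
  rw [A2H_eq, Pihat1, frakA, fromBlocks_mul_fromRows, fromRows_mul]
  ext (⟨a, l⟩ | ⟨a, l⟩) ⟨⟨d, b⟩, l'⟩
  · simp only [Matrix.add_apply, Matrix.smul_apply, fromRows_apply_inl, Matrix.zero_mul, add_zero, Matrix.zero_apply,
      smul_zero, kron_mul_apply, mul_kron2_apply]
    simp [M21, ite_and]
  · simp only [Matrix.add_apply, Matrix.smul_apply, fromRows_apply_inr, Matrix.zero_mul, zero_add,
      kron_mul_apply, mul_kron2_apply, Lp_mul_apply, mul_M22_apply]
    have := aux_main_z m₂ z (fun r => (2:ℂ)⁻¹ * t 0 r l l' +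
      ∑ s ∈ Finset.range (d : ℕ), t (-((s : ℤ) + 1)) r l l') a b
    have hK : K12 m₁ m₂ m₃ t (a, l) (d, l') =
        ((2:ℂ)⁻¹ * ((2:ℂ)⁻¹ * t 0 0 l l' +
          ∑ s ∈ Finset.range (d : ℕ), t (-((s : ℤ) + 1)) 0 l l') +
        ∑ j ∈ Finset.range a, ((2:ℂ)⁻¹ * t 0 ((j:ℤ) + 1) l l' +
          ∑ s ∈ Finset.range (d : ℕ), t (-((s : ℤ) + 1)) ((j:ℤ) + 1) l l')) := by
      simp only [K12, M12blk, of_apply, Matrix.add_apply, Matrix.smul_apply, Matrix.sum_apply, smul_eq_mul,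
        Finset.sum_add_distrib, ← Finset.mul_sum]
      rw [Finset.sum_comm]; ring
    have hK' : Kmat m₁ m₂ m₃ t l ((d, b), l') =
        ((2:ℂ)⁻¹ * ((2:ℂ)⁻¹ * t 0 0 l l' +
          ∑ s ∈ Finset.range (d : ℕ), t (-((s : ℤ) + 1)) 0 l l') +
        ∑ j ∈ Finset.range b, ((2:ℂ)⁻¹ * t 0 (-((j:ℤ) + 1)) l l' +
          ∑ s ∈ Finset.range (d : ℕ), t (-((s : ℤ) + 1)) (-((j:ℤ) + 1)) l l')) := by
      simp only [Kmat, M42blk, of_apply, Matrix.add_apply, Matrix.smul_apply, Matrix.sum_apply, smul_eq_mul,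
        Finset.sum_add_distrib, ← Finset.mul_sum]
      rw [Finset.sum_comm]; ring
    rw [hK, hK', smul_eq_mul]
    simpa only [M41, calT, of_apply, Matrix.add_apply, Matrix.smul_apply, Matrix.sum_apply, smul_eq_mul] using this

/-- `Π̂_p (A_k^* - λ_k I)⁻¹ = 𝔄_k(λ_k)⁻¹ (Π̂_p + i col[0; Q_k] (A_k^* - λ_k I)⁻¹)`,
where `Q₁ = K₁₁M₂₁ + ℒ₁K`, `Q₂ = K₁₂M₂₂ + ℒ₂K`, for `{k, p} = {1, 2}`, `k ≠ p`. -/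
theorem statement11 (m₁ m₂ m₃ : ℕ) (hm₁ : 2 ≤ m₁) (hm₂ : 2 ≤ m₂) (hm₃ : 2 ≤ m₃)
    (t : ℤ → ℤ → Matrix (Fin m₃) (Fin m₃) ℂ) (hT : IsUnit (Tmat m₁ m₂ m₃ t))
    (l₁ l₂ : ℂ)
    (hl₁ : l₁ ≠ Complex.I / 2) (hl₁' : l₁ ≠ -(Complex.I / 2))
    (hl₂ : l₂ ≠ Complex.I / 2) (hl₂' : l₂ ≠ -(Complex.I / 2)) :
    Pihat1 m₁ m₂ m₃ t * ((A2 m₁ m₂ m₃)ᴴ - l₂ • 1)⁻¹ =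
      (frakA m₂ m₃ l₂)⁻¹ * (Pihat1 m₁ m₂ m₃ t +
        Complex.I • (Matrix.fromRows 0
            (K12 m₁ m₂ m₃ t * M22 m₁ m₂ m₃ + Lp m₂ m₃ * Kmat m₁ m₂ m₃ t) *
          ((A2 m₁ m₂ m₃)ᴴ - l₂ • 1)⁻¹)) ∧
    Pihat2 m₁ m₂ m₃ t * ((A1 m₁ m₂ m₃)ᴴ - l₁ • 1)⁻¹ =
      (frakA m₁ m₃ l₁)⁻¹ * (Pihat2 m₁ m₂ m₃ t +
        Complex.I • (Matrix.fromRows 0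
            (K11 m₁ m₂ m₃ t * M21 m₁ m₂ m₃ + Lp m₁ m₃ * Kmat m₁ m₂ m₃ t) *
          ((A1 m₁ m₂ m₃)ᴴ - l₁ • 1)⁻¹)) := by
  exact ⟨conj_step _ _ _ _ (isUnit_frakA m₂ m₃ l₂ hl₂ hl₂') (isUnit_A2H m₁ m₂ m₃ l₂ hl₂')
      (main2 m₁ m₂ m₃ t l₂),
    conj_step _ _ _ _ (isUnit_frakA m₁ m₃ l₁ hl₁ hl₁') (isUnit_A1H m₁ m₂ m₃ l₁ hl₁')
      (main1 m₁ m₂ m₃ t l₁)⟩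

end TBT
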